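/- Let k be a positive integer, let G be a graph and let H be an induced subgraph of G with δ(H) ≥ max{5k−3, |V(H)|−k}. Suppose G has a system of T-segments {P_1,…,P_r} with terminal set T = V(H), where r ≤ k and the total number of vertices of the paths lying outside V(H) is at least p. Then G contains a cycle with at least |V(H)|+p vertices. -/

import Mathlib

open SimpleGraph

/-- A (simple) path in `G`, packaged with its two end-vertices. -/
structure PathIn {V : Type*} (G : SimpleGraph V) where
  first : V
  last : V
  walk : G.Walk first last
  isPath : walk.IsPath

namespace PathIn

variable {V : Type*} {G : SimpleGraph V}

/-- The vertex set of the path. -/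
def verts (P : PathIn G) : Set V := {x | x ∈ P.walk.support}

/-- The internal (non-end) vertices of the path. -/
def internals (P : PathIn G) : Set V := {x | x ∈ P.walk.support.tail.dropLast}

/-- `x` is an end-vertex of the path. -/
def IsEndpoint (P : PathIn G) (x : V) : Prop := x = P.first ∨ x = P.last

end PathIn

/-- A path `P` is a one-terminal `T`-segment if it has at least 2 vertices, exactly
one of its end-vertices is in `T`, and all its other vertices are outside `T`. -/
def IsOneTerminalSegment {V : Type*} (G : SimpleGraph V) (T : Set V) (P : PathIn G) : Prop :=
  2 ≤ P.walk.support.length ∧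
    ((P.first ∈ T ∧ ∀ x ∈ P.walk.support.tail, x ∉ T) ∨
     (P.last ∈ T ∧ ∀ x ∈ P.walk.support.dropLast, x ∉ T))

/-- A path `P` is a two-terminal `T`-segment if it has at least 3 vertices, both of
its end-vertices are in `T`, and all its internal vertices are outside `T`. -/
def IsTwoTerminalSegment {V : Type*} (G : SimpleGraph V) (T : Set V) (P : PathIn G) : Prop :=
  3 ≤ P.walk.support.length ∧ P.first ∈ T ∧ P.last ∈ T ∧ ∀ x ∈ P.internals, x ∉ T

/-- The union of a family of paths, as a simple graph on the vertices of `G`. -/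
def segUnionGraph {V : Type*} {G : SimpleGraph V} {r : ℕ} (P : Fin r → PathIn G) :
    SimpleGraph V :=
  (⨆ i, (P i).walk.toSubgraph).spanningCoe

/-- A linear forest: a graph each of whose connected components is a path,
equivalently (for finite graphs) an acyclic graph of maximum degree at most 2. -/
def IsLinearForest {V : Type*} (F : SimpleGraph V) : Prop :=
  F.IsAcyclic ∧ ∀ v : V, (F.neighborSet v).ncard ≤ 2

/-- The paths `P i` are pairwise internally vertex-disjoint: a common vertex of two
of the paths must be an end-vertex of both. -/
def InternallyDisjoint {V : Type*} {G : SimpleGraph V} {r : ℕ} (P : Fin r → PathIn G) : Prop :=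
  ∀ i j : Fin r, i ≠ j → ∀ x : V, x ∈ (P i).verts → x ∈ (P j).verts →
    (P i).IsEndpoint x ∧ (P j).IsEndpoint x

/-- A system of `T`-segments: a family of two-terminal `T`-segments that are pairwise
internally vertex-disjoint and whose union is a linear forest. -/
def IsSegmentSystem {V : Type*} (G : SimpleGraph V) (T : Set V) {r : ℕ}
    (P : Fin r → PathIn G) : Prop :=
  (∀ i, IsTwoTerminalSegment G T (P i)) ∧
  InternallyDisjoint P ∧
  IsLinearForest (segUnionGraph P)

/-- An extended system of `T`-segments: (i) at least one and at most two of the paths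
are one-terminal `T`-segments and the remaining ones are two-terminal `T`-segments;
(ii) the paths are pairwise internally vertex-disjoint and the end-vertex outside `T`
of each one-terminal segment is distinct from all other vertices of the paths;
(iii) the union of the paths is a linear forest, and if there are two one-terminal
segments then their vertices lie in distinct components of this forest. -/
def IsExtendedSegmentSystem {V : Type*} (G : SimpleGraph V) (T : Set V) {r : ℕ}
    (P : Fin r → PathIn G) : Prop :=
  (∃ i, IsOneTerminalSegment G T (P i)) ∧
  (∀ i j l : Fin r, IsOneTerminalSegment G T (P i) → IsOneTerminalSegment G T (P j) →
      IsOneTerminalSegment G T (P l) → i = j ∨ i = l ∨ j = l) ∧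
  (∀ i, IsOneTerminalSegment G T (P i) ∨ IsTwoTerminalSegment G T (P i)) ∧
  InternallyDisjoint P ∧
  (∀ i, IsOneTerminalSegment G T (P i) → ∀ x : V, (P i).IsEndpoint x → x ∉ T →
      ∀ j, j ≠ i → x ∉ (P j).verts) ∧
  IsLinearForest (segUnionGraph P) ∧
  (∀ i j : Fin r, i ≠ j → IsOneTerminalSegment G T (P i) → IsOneTerminalSegment G T (P j) →
      ∀ x ∈ (P i).verts, ∀ y ∈ (P j).verts, ¬ (segUnionGraph P).Reachable x y)

/-- The total number of vertices of the paths of the family lying outside `T`. -/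
noncomputable def outsideCount {V : Type*} {G : SimpleGraph V} {r : ℕ} (T : Set V)
    (P : Fin r → PathIn G) : ℕ :=
  ((⋃ i, (P i).verts) \ T).ncard

/-- `H` is a `d`-core of `G`: an inclusion-maximal vertex set inducing a connected
subgraph of minimum degree at least `d`. -/
def IsDCore {V : Type*} (G : SimpleGraph V) (d : ℕ) (H : Set V) : Prop :=
  (G.induce H).Connected ∧
  (∀ v ∈ H, d ≤ (G.neighborSet v ∩ H).ncard) ∧
  ∀ H' : Set V, H ⊆ H' → (G.induce H').Connected →
    (∀ v ∈ H', d ≤ (G.neighborSet v ∩ H').ncard) → H' = H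

/-- `x` and `y` are consecutive entries, in either order, of the list `l`. -/
def ListAdj {α : Type*} (l : List α) (x y : α) : Prop := [x, y] <:+: l ∨ [y, x] <:+: l

/-- `x` and `y` are consecutive entries, in either order, of the list `l` read cyclically. -/
def CyclicAdj {α : Type*} (l : List α) (x y : α) : Prop :=
  ListAdj l x y ∨ (l.head? = some x ∧ l.getLast? = some y) ∨
    (l.head? = some y ∧ l.getLast? = some x)

section ListAdj

variable {α : Type*}

lemma pair_infix_cons_iff (a : α) (l : List α) (x y : α) :
    [x, y] <:+: a :: l ↔ (x = a ∧ l.head? = some y) ∨ [x, y] <:+: l := by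
  rw [List.infix_cons_iff]
  cases l <;> simp [List.cons_prefix_cons, eq_comm (a := y)]

lemma pair_infix_append_iff (l m : List α) (x y : α) :
    [x, y] <:+: l ++ m ↔
      [x, y] <:+: l ∨ [x, y] <:+: m ∨ (l.getLast? = some x ∧ m.head? = some y) := by
  induction l with
  | nil => simp
  | cons a l ih =>
    rw [List.cons_append, pair_infix_cons_iff, ih, pair_infix_cons_iff]
    cases l with
    | nil => simp [eq_comm (a := x), or_comm]
    | cons b l => simp; tauto

lemma pair_infix_of_getElem? {l : List α} {i : ℕ} {x y : α} (hx : l[i]? = some x)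
    (hy : l[i + 1]? = some y) : [x, y] <:+: l := by
  induction l generalizing i with
  | nil => simp at hx
  | cons a l ih =>
    rw [pair_infix_cons_iff]
    cases i with
    | zero => exact Or.inl ⟨by simpa [eq_comm] using hx, by simpa [List.head?_eq_getElem?] using hy⟩
    | succ i => exact Or.inr (ih (by simpa using hx) (by simpa using hy))

lemma listAdj_comm {l : List α} {x y : α} : ListAdj l x y ↔ ListAdj l y x := or_comm

lemma cyclicAdj_comm {l : List α} {x y : α} : CyclicAdj l x y ↔ CyclicAdj l y x := by
  unfold CyclicAdj
  rw [listAdj_comm]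
  tauto

lemma listAdj_append_iff (l m : List α) (x y : α) :
    ListAdj (l ++ m) x y ↔ ListAdj l x y ∨ ListAdj m x y ∨
      (l.getLast? = some x ∧ m.head? = some y) ∨ (l.getLast? = some y ∧ m.head? = some x) := by
  unfold ListAdj
  rw [pair_infix_append_iff, pair_infix_append_iff]
  tauto

lemma listAdj_reverse_iff (l : List α) (x y : α) : ListAdj l.reverse x y ↔ ListAdj l x y := by
  have h : ∀ u v : α, [u, v] <:+: l.reverse ↔ [v, u] <:+: l := fun u v ↦ by
    rw [← List.reverse_infix]; simp
  unfold ListAdj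
  rw [h, h, or_comm]

lemma listAdj_cons_iff (a : α) (l : List α) (x y : α) :
    ListAdj (a :: l) x y ↔
      ListAdj l x y ∨ (x = a ∧ l.head? = some y) ∨ (y = a ∧ l.head? = some x) := by
  unfold ListAdj
  rw [pair_infix_cons_iff, pair_infix_cons_iff]
  tauto

lemma ListAdj.mem_left {l : List α} {x y : α} (h : ListAdj l x y) : x ∈ l := by
  rcases h with h | h <;> exact h.subset (by simp)

lemma ListAdj.mem_right {l : List α} {x y : α} (h : ListAdj l x y) : y ∈ l :=
  (listAdj_comm.1 h).mem_left

lemma cyclicAdj_append_iff {l m : List α} (hl : l ≠ []) (hm : m ≠ []) (x y : α) :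
    CyclicAdj (l ++ m) x y ↔ ListAdj l x y ∨ ListAdj m x y ∨
      ((l.getLast? = some x ∧ m.head? = some y) ∨ (l.getLast? = some y ∧ m.head? = some x)) ∨
      ((m.getLast? = some x ∧ l.head? = some y) ∨ (m.getLast? = some y ∧ l.head? = some x)) := by
  unfold CyclicAdj
  rw [listAdj_append_iff, List.head?_append_of_ne_nil _ hl, List.getLast?_append_of_ne_nil _ hm]
  tauto

lemma cyclicAdj_append_comm (l m : List α) (x y : α) :
    CyclicAdj (l ++ m) x y ↔ CyclicAdj (m ++ l) x y := by
  rcases eq_or_ne l [] with rfl | hl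
  · simp
  rcases eq_or_ne m [] with rfl | hm
  · simp
  rw [cyclicAdj_append_iff hl hm, cyclicAdj_append_iff hm hl]
  tauto

/-- A cyclically consecutive pair can be moved to the two ends of the list. -/
lemma CyclicAdj.exists_perm {l : List α} {a b : α} (h : CyclicAdj l a b) :
    ∃ m : List α, m.Perm l ∧ (∀ x y, CyclicAdj m x y ↔ CyclicAdj l x y) ∧
      ((m.head? = some b ∧ m.getLast? = some a) ∨ (m.head? = some a ∧ m.getLast? = some b)) := by
  have key : ∀ u v : α, [u, v] <:+: l → ∃ m : List α, m.Perm l ∧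
      (∀ x y, CyclicAdj m x y ↔ CyclicAdj l x y) ∧ m.head? = some v ∧ m.getLast? = some u := by
    rintro u v ⟨s, t, rfl⟩
    refine ⟨(v :: t) ++ (s ++ [u]), ?_, fun x y ↦ ?_, by simp,
      by rw [← List.append_assoc, List.getLast?_concat]⟩
    · simpa using (List.perm_append_comm : ((v :: t) ++ (s ++ [u])).Perm _)
    · rw [cyclicAdj_append_comm]; simp
  rcases h with (h | h) | h | h
  · obtain ⟨m, h1, h2, h3⟩ := key a b h
    exact ⟨m, h1, h2, Or.inl h3⟩
  · obtain ⟨m, h1, h2, h3⟩ := key b a h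
    exact ⟨m, h1, h2, Or.inr h3⟩
  · exact ⟨l, .refl _, fun _ _ ↦ Iff.rfl, Or.inr h⟩
  · exact ⟨l, .refl _, fun _ _ ↦ Iff.rfl, Or.inl h⟩

/-- In a list without repetitions, the neighbours of an entry are the entries
just before and just after it. -/
lemma listAdj_append_cons_self_iff {s t : List α} {x y : α} (h : (s ++ x :: t).Nodup) :
    ListAdj (s ++ x :: t) x y ↔ s.getLast? = some y ∨ t.head? = some y := by
  have hs : x ∉ s := by grind
  have ht : x ∉ t := by grind
  rw [listAdj_append_iff, listAdj_cons_iff]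
  have h1 : ¬ ListAdj s x y := fun h ↦ hs h.mem_left
  have h2 : ¬ ListAdj t x y := fun h ↦ ht h.mem_left
  have h3 : s.getLast? ≠ some x := fun h ↦ hs (List.mem_of_getLast? h)
  have h4 : t.head? ≠ some x := fun h ↦ ht (List.mem_of_head? h)
  simp [h1, h2, h3, h4]
  tauto

end ListAdj

/-- A finite acyclic graph has a vertex of degree at most one. -/
lemma SimpleGraph.IsAcyclic.exists_subsingleton_neighborSet {V : Type*} [Finite V] [Nonempty V]
    {F : SimpleGraph V} (hF : F.IsAcyclic) : ∃ x, (F.neighborSet x).Subsingleton := by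
  have := Fintype.ofFinite V
  obtain ⟨u, v, p, hp, hmax⟩ := Walk.exists_isPath_forall_isPath_length_le_length F
  have key : ∀ w, F.Adj u w → w = p.snd := fun w hw ↦ by
    refine hF.eq_snd_of_adj_start hp hw ?_
    by_contra hn
    have := hmax w v (Walk.cons hw.symm p) (hp.cons hn)
    simp at this
  exact ⟨u, fun y hy z hz ↦ (key y hy).trans (key z hz).symm⟩

/-- The vertices of a linear forest can be listed so that adjacent vertices are consecutive. -/
lemma IsLinearForest.exists_list {V : Type*} [Finite V] {F : SimpleGraph V}
    (hF : IsLinearForest F) (S : Finset V) :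
    ∃ l : List V, l.Nodup ∧ (∀ x, x ∈ l ↔ x ∈ S) ∧
      ∀ x ∈ S, ∀ y ∈ S, F.Adj x y → ListAdj l x y := by
  classical
  induction S using Finset.strongInduction with
  | H S ih =>
  rcases S.eq_empty_or_nonempty with rfl | hS
  · exact ⟨[], by simp⟩
  have : Nonempty (S : Set V) := hS.to_subtype
  obtain ⟨⟨x, hx⟩, hleaf⟩ := (hF.1.induce (S : Set V)).exists_subsingleton_neighborSet
  replace hleaf : ∀ y ∈ S, ∀ z ∈ S, F.Adj x y → F.Adj x z → y = z := fun y hy z hz h1 h2 ↦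
    congrArg Subtype.val (@hleaf ⟨y, hy⟩ (by simpa using h1) ⟨z, hz⟩ (by simpa using h2))
  replace hx : x ∈ S := hx
  obtain ⟨l, hnd, hmem, hadj⟩ := ih (S.erase x) (Finset.erase_ssubset hx)
  have hxl : x ∉ l := by simp [hmem]
  by_cases hy : ∃ y ∈ S, F.Adj x y
  · obtain ⟨y, hyS, hxy⟩ := hy
    obtain ⟨s, t, rfl⟩ := List.append_of_mem ((hmem y).2 (by simp [hyS, hxy.ne']))
    suffices h : ∃ l' : List V, l'.Perm (x :: (s ++ y :: t)) ∧ ListAdj l' x y ∧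
        ∀ u v, F.Adj u v → ListAdj (s ++ y :: t) u v → ListAdj l' u v by
      obtain ⟨l', hperm, h1, h2⟩ := h
      refine ⟨l', hperm.nodup_iff.2 (by simp_all), fun z ↦ ?_, fun u hu v hv huv ↦ ?_⟩
      · rw [hperm.mem_iff, List.mem_cons, hmem]
        grind
      · by_cases hux : u = x
        · subst hux
          rwa [← hleaf y hyS v hv hxy huv]
        · by_cases hvx : v = x
          · subst hvx
            rw [← hleaf y hyS u hu hxy huv.symm, listAdj_comm]
            exact h1
          · exact h2 u v huv (hadj u (by simp [hu, hux]) v (by simp [hv, hvx]) huv)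
    by_cases hs : ∃ z, s.getLast? = some z ∧ F.Adj y z
    · obtain ⟨z, hz, hyz⟩ := hs
      have ht : ∀ w, t.head? = some w → ¬ F.Adj y w := by
        intro w hw hyw
        have hzs := List.mem_of_getLast? hz
        have hwt := List.mem_of_head? hw
        have hsub : ({x, z, w} : Set V) ⊆ F.neighborSet y := by
          rintro u (rfl | rfl | rfl)
          exacts [hxy.symm, hyz, hyw]
        have hc := Set.ncard_le_ncard hsub (Set.toFinite _)
        have h3 : ({x, z, w} : Set V).ncard = 3 :=
          Set.ncard_eq_three.2 ⟨x, z, w, by grind, by grind, by grind, rfl⟩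
        have := hF.2 y
        omega
      refine ⟨(s ++ [y]) ++ x :: t, ?_, ?_, fun u v huv h ↦ ?_⟩
      · simpa using (List.perm_middle : ((s ++ [y]) ++ x :: t).Perm _)
      · simp [listAdj_append_iff, listAdj_cons_iff]
      · rw [listAdj_append_iff, listAdj_cons_iff] at h
        simp only [listAdj_append_iff, listAdj_cons_iff, List.head?_cons]
        grind [SimpleGraph.Adj.symm]
    · refine ⟨s ++ x :: y :: t, ?_, ?_, fun u v huv h ↦ ?_⟩
      · exact List.perm_middle
      · simp [listAdj_append_iff, listAdj_cons_iff]
      · rw [listAdj_append_iff, listAdj_cons_iff] at h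
        simp only [listAdj_append_iff, listAdj_cons_iff, List.head?_cons]
        grind [SimpleGraph.Adj.symm]
  · refine ⟨x :: l, by simp [hxl, hnd], fun z ↦ ?_, fun u hu v hv huv ↦ ?_⟩
    · rw [List.mem_cons, hmem]
      grind
    · rw [listAdj_cons_iff]
      refine Or.inl (hadj u ?_ v ?_ huv)
      · simp only [Finset.mem_erase, hu, and_true]
        rintro rfl
        exact hy ⟨v, hv, huv⟩
      · simp only [Finset.mem_erase, hv, and_true]
        rintro rfl
        exact hy ⟨u, hu, huv.symm⟩

/-- A list of at least three distinct vertices that is cyclically a chain of adjacent vertices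
gives a cycle of the same length. -/
lemma exists_isCycle_of_cyclicAdj {V : Type*} {G : SimpleGraph V} {l : List V}
    (hnd : l.Nodup) (hlen : 3 ≤ l.length) (h : ∀ x y, CyclicAdj l x y → G.Adj x y) :
    ∃ (v : V) (c : G.Walk v v), c.IsCycle ∧ c.length = l.length := by
  have hne : l ≠ [] := by rintro rfl; simp at hlen
  have hchain : l.IsChain G.Adj := List.isChain_iff_forall_rel_of_append_cons_cons.2
    fun {a b s t} hl ↦ h a b (Or.inl (Or.inl ⟨s, t, by simp [hl]⟩))
  have hadj : G.Adj (l.getLast hne) (l.head hne) :=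
    h _ _ (Or.inr (Or.inr ⟨List.head?_eq_some_head hne, List.getLast?_eq_some_getLast hne⟩))
  set p := Walk.ofSupport l hne hchain with hpdef
  have hp : p.IsPath := by
    rw [Walk.isPath_def, hpdef, Walk.support_ofSupport]
    exact hnd
  have hplen : p.length = l.length - 1 := Walk.length_ofSupport hne hchain
  refine ⟨_, Walk.cons hadj p, (Walk.cons_isCycle_iff p hadj).2 ⟨hp, fun hmem ↦ ?_⟩, ?_⟩
  · rw [Sym2.eq_swap, ← Walk.adj_toSubgraph_iff_mem_edges] at hmem
    have h1 : p.getVert 1 = l.getLast hne := hp.snd_of_toSubgraph_adj hmem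
    have := hp.getVert_injOn (by rw [Set.mem_ofPred_eq]; lia) (by rw [Set.mem_ofPred_eq])
      (h1.trans p.getVert_length.symm)
    omega
  · rw [Walk.length_cons, hplen]
    omega

/-- A crossing pair: if a list starts with `b` and ends with `a`, then under suitable degree
conditions it has consecutive entries `u, w` in `H` with `a` adjacent to `u` and `b` to `w`. -/
lemma exists_crossing {V : Type*} [Finite V] {G : SimpleGraph V} {H D : Set V} {d : ℕ} {a b : V}
    {m : List V} (hnd : m.Nodup) (hHm : ∀ x ∈ H, x ∈ m) (haH : a ∈ H)
    (hb : m.head? = some b) (ha : m.getLast? = some a)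
    (hD : ∀ x y, [x, y] <:+: m → x ∉ H → y ∈ H → y ∈ D)
    (hda : d ≤ (G.neighborSet a ∩ H).ncard) (hdb : d ≤ (G.neighborSet b ∩ H).ncard)
    (hcard : H.ncard + D.ncard ≤ 2 * d) :
    ∃ (A B : List V) (u w : V), m = A ++ B ∧ A.getLast? = some u ∧ B.head? = some w ∧
      u ∈ H ∧ w ∈ H ∧ G.Adj a u ∧ G.Adj b w := by
  classical
  by_contra hcon
  set N := m.length with hN
  have hNpos : 0 < N := List.length_pos_iff.2 (by rintro rfl; simp at hb)
  set f : ℕ → V := fun i ↦ m.getD i a with hf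
  have hfget : ∀ i, i < N → m[i]? = some (f i) := fun i hi ↦ by
    simp [hf, List.getD_eq_getElem?_getD, List.getElem?_eq_getElem hi]
  have hfinj : ∀ i j, i < N → j < N → f i = f j → i = j := fun i j hi hj hij ↦ by
    refine (List.getElem?_inj hi hnd).1 ?_
    rw [hfget i hi, hfget j hj, hij]
  have hfsurj : ∀ x ∈ H, ∃ i, i < N ∧ f i = x := fun x hx ↦ by
    obtain ⟨i, hi, rfl⟩ := List.getElem_of_mem (hHm x hx)
    exact ⟨i, hi, by simpa [List.getElem?_eq_getElem hi] using (hfget i hi).symm⟩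
  have hf0 : f 0 = b := by
    rw [List.head?_eq_getElem?, hfget 0 hNpos] at hb
    exact Option.some_injective _ hb
  have hfl : f (N - 1) = a := by
    rw [List.getLast?_eq_getElem?, hfget (N - 1) (by omega)] at ha
    exact Option.some_injective _ ha
  have hcons : ∀ i, i + 1 < N → [f i, f (i + 1)] <:+: m := fun i hi ↦
    pair_infix_of_getElem? (hfget i (by omega)) (hfget (i + 1) hi)
  let I₁ : Finset ℕ := (Finset.range (N - 1)).filter fun i ↦ f i ∈ G.neighborSet a ∩ H
  let I₂ : Finset ℕ := (Finset.range (N - 1)).filter fun i ↦ f (i + 1) ∈ G.neighborSet b ∩ H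
  let J₁ : Finset ℕ := (Finset.range (N - 1)).filter fun i ↦ f i ∈ H
  let J₂ : Finset ℕ := (Finset.range (N - 1)).filter fun i ↦ f i ∉ H ∧ f (i + 1) ∈ H
  have hI₁ : d ≤ I₁.card := by
    refine hda.trans ?_
    rw [← Set.ncard_coe_finset]
    refine (Set.ncard_le_ncard (t := f '' I₁) ?_ (Set.toFinite _)).trans
      (Set.ncard_image_le (Set.toFinite _))
    rintro x ⟨hxa, hxH⟩
    obtain ⟨i, hi, rfl⟩ := hfsurj x hxH
    have : i ≠ N - 1 := by
      rintro rfl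
      rw [hfl] at hxa
      exact G.loopless.irrefl a hxa
    exact ⟨i, by simpa [I₁] using ⟨by omega, hxa, hxH⟩, rfl⟩
  have hI₂ : d ≤ I₂.card := by
    refine hdb.trans ?_
    rw [← Set.ncard_coe_finset]
    refine (Set.ncard_le_ncard (t := (fun i ↦ f (i + 1)) '' I₂) ?_ (Set.toFinite _)).trans
      (Set.ncard_image_le (Set.toFinite _))
    rintro x ⟨hxb, hxH⟩
    obtain ⟨i, hi, rfl⟩ := hfsurj x hxH
    obtain _ | i := i
    · rw [hf0] at hxb
      exact (G.loopless.irrefl b hxb).elim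
    exact ⟨i, by simpa [I₂] using ⟨by omega, hxb, hxH⟩, rfl⟩
  have hJ₁ : J₁.card + 1 ≤ H.ncard := by
    have h1 : (f '' J₁).ncard = J₁.card := by
      rw [Set.InjOn.ncard_image, Set.ncard_coe_finset]
      intro i hi j hj hij
      simp only [J₁, Finset.coe_filter, Finset.mem_range, Set.mem_ofPred_eq] at hi hj
      exact hfinj i j (by omega) (by omega) hij
    rw [← h1, ← Set.ncard_sdiff_singleton_add_one haH (Set.toFinite _)]
    refine Nat.add_le_add_right (Set.ncard_le_ncard ?_ (Set.toFinite _)) 1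
    rintro _ ⟨i, hi, rfl⟩
    simp only [J₁, Finset.coe_filter, Finset.mem_range, Set.mem_ofPred_eq] at hi
    refine ⟨hi.2, fun hia ↦ ?_⟩
    have := hfinj i (N - 1) (by omega) (by omega) (by rw [hfl]; exact hia)
    omega
  have hJ₂ : J₂.card ≤ D.ncard := by
    rw [← Set.ncard_coe_finset]
    refine Set.ncard_le_ncard_of_injOn (fun i ↦ f (i + 1)) ?_ ?_ (Set.toFinite _)
    · intro i hi
      simp only [J₂, Finset.coe_filter, Finset.mem_range, Set.mem_ofPred_eq] at hi
      exact hD (f i) _ (hcons i (by omega)) hi.2.1 hi.2.2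
    · intro i hi j hj hij
      simp only [J₂, Finset.coe_filter, Finset.mem_range, Set.mem_ofPred_eq] at hi hj
      have := hfinj (i + 1) (j + 1) (by omega) (by omega) hij
      omega
  have hdisj : Disjoint I₁ I₂ := by
    rw [Finset.disjoint_left]
    intro i hi₁ hi₂
    simp only [I₁, I₂, Finset.mem_filter, Finset.mem_range] at hi₁ hi₂
    refine hcon ⟨m.take (i + 1), m.drop (i + 1), f i, f (i + 1), by simp, ?_, ?_,
      hi₁.2.2, hi₂.2.2, hi₁.2.1, hi₂.2.1⟩
    · rw [List.getLast?_take]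
      simp [hfget i (by omega)]
    · rw [List.head?_drop, hfget (i + 1) (by omega)]
  have hsub : I₁ ∪ I₂ ⊆ J₁ ∪ J₂ := by
    intro i hi
    simp only [I₁, I₂, J₁, J₂, Finset.mem_union, Finset.mem_filter, Set.mem_inter_iff] at hi ⊢
    tauto
  have h1 := Finset.card_le_card hsub
  rw [Finset.card_union_of_disjoint hdisj] at h1
  have h2 := Finset.card_union_le J₁ J₂
  omega

/-- The pairs of vertices that are cyclically consecutive in `l` but not adjacent in `G`. -/
def cyclicGaps {V : Type*} (G : SimpleGraph V) (l : List V) : Set (Sym2 V) :=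
  {e | ∃ x y, e = s(x, y) ∧ CyclicAdj l x y ∧ ¬ G.Adj x y}

/-- Rotating at a crossing pair removes a gap. -/
lemma cyclicGaps_reverse_ssubset {V : Type*} {G : SimpleGraph V} {A B : List V} {a b u w : V}
    (hnd : (A ++ B).Nodup) (hA : A.head? = some b) (hB : B.getLast? = some a)
    (hu : A.getLast? = some u) (hw : B.head? = some w) (hau : G.Adj a u) (hbw : G.Adj b w)
    (hab : ¬ G.Adj a b) : cyclicGaps G (A ++ B.reverse) ⊂ cyclicGaps G (A ++ B) := by
  have hAne : A ≠ [] := by rintro rfl; simp at hA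
  have hBne : B ≠ [] := by rintro rfl; simp at hB
  have hdisj : ∀ x ∈ A, x ∉ B := fun x h1 h2 ↦ (List.disjoint_of_nodup_append hnd) h1 h2
  have hbA := List.mem_of_head? hA
  have haB := List.mem_of_getLast? hB
  have huA := List.mem_of_getLast? hu
  have hwB := List.mem_of_head? hw
  have hold := cyclicAdj_append_iff hAne hBne
  have hnew := cyclicAdj_append_iff hAne (m := B.reverse) (by simpa using hBne)
  simp only [listAdj_reverse_iff, List.head?_reverse, List.getLast?_reverse, hA, hB, hu, hw,
    Option.some.injEq] at hold hnew
  refine ⟨?_, fun hsub ↦ ?_⟩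
  · rintro _ ⟨x, y, rfl, hxy, hG⟩
    refine ⟨x, y, rfl, ?_, hG⟩
    rw [hnew] at hxy
    rw [hold]
    rcases hxy with h | h | h | h
    · exact Or.inl h
    · exact Or.inr (Or.inl h)
    · rcases h with ⟨rfl, rfl⟩ | ⟨rfl, rfl⟩
      · exact (hG hau.symm).elim
      · exact (hG hau).elim
    · rcases h with ⟨rfl, rfl⟩ | ⟨rfl, rfl⟩
      · exact (hG hbw.symm).elim
      · exact (hG hbw).elim
  · have hmem : s(a, b) ∈ cyclicGaps G (A ++ B) := ⟨a, b, rfl, by rw [hold]; tauto, hab⟩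
    obtain ⟨x, y, he, hxy, -⟩ := hsub hmem
    have hab' : CyclicAdj (A ++ B.reverse) a b := by
      rcases Sym2.eq_iff.1 he with ⟨rfl, rfl⟩ | ⟨rfl, rfl⟩
      · exact hxy
      · exact cyclicAdj_comm.1 hxy
    rw [hnew] at hab'
    rcases hab' with h | h | h | h
    · exact hdisj a h.mem_left haB
    · exact hdisj b hbA h.mem_right
    · rcases h with ⟨h, -⟩ | ⟨h, -⟩
      · exact hdisj a (h ▸ huA) haB
      · exact hab (h ▸ hau)
    · rcases h with ⟨h, -⟩ | ⟨-, h⟩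
      · exact hab (h ▸ hbw).symm
      · exact hdisj b hbA (h ▸ haB)

/-- A cyclic ordering in which all consecutive pairs outside `H` are edges of `F` can be rearranged
so that all consecutive pairs are edges of `G`. -/
lemma exists_perm_cyclicAdj_imp_adj {V : Type*} [Finite V] {F G : SimpleGraph V} {H D : Set V}
    {d : ℕ} (hFG : F ≤ G) (hd : ∀ x ∈ H, d ≤ (G.neighborSet x ∩ H).ncard)
    (hFD : ∀ x y, F.Adj x y → x ∉ H → y ∈ H → y ∈ D)
    (hcard : (∃ a ∈ H, ∃ b ∈ H, a ≠ b ∧ ¬ G.Adj a b) → H.ncard + D.ncard ≤ 2 * d)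
    {l : List V} (hnd : l.Nodup) (hlen : 2 ≤ l.length) (hHl : ∀ x ∈ H, x ∈ l)
    (hl : ∀ x y, CyclicAdj l x y → F.Adj x y ∨ (x ∈ H ∧ y ∈ H)) :
    ∃ m : List V, m.Perm l ∧ ∀ x y, CyclicAdj m x y → G.Adj x y := by
  induction hn : (cyclicGaps G l).ncard using Nat.strong_induction_on generalizing l with
  | _ n ih =>
  subst hn
  by_cases hall : ∀ x y, CyclicAdj l x y → G.Adj x y
  · exact ⟨l, .refl _, hall⟩
  push Not at hall
  obtain ⟨a₀, b₀, hadj₀, hG₀⟩ := hall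
  obtain ⟨m, hperm, hiff, hends⟩ := hadj₀.exists_perm
  obtain ⟨a, b, hadj, hG, hb, ha⟩ : ∃ a b, CyclicAdj l a b ∧ ¬ G.Adj a b ∧
      m.head? = some b ∧ m.getLast? = some a := by
    rcases hends with h | h
    · exact ⟨a₀, b₀, hadj₀, hG₀, h⟩
    · exact ⟨b₀, a₀, cyclicAdj_comm.1 hadj₀, fun h ↦ hG₀ h.symm, h⟩
  have hgap : cyclicGaps G m = cyclicGaps G l := by simp only [cyclicGaps, hiff]
  have hmnd : m.Nodup := hperm.nodup_iff.2 hnd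
  obtain ⟨haH, hbH⟩ : a ∈ H ∧ b ∈ H := (hl a b hadj).resolve_left fun h ↦ hG (hFG h)
  have hne : a ≠ b := by
    rintro rfl
    have hmlen : 2 ≤ m.length := hperm.length_eq ▸ hlen
    rw [List.head?_eq_getElem?] at hb
    rw [List.getLast?_eq_getElem?, ← hb, List.getElem?_inj (by omega) hmnd] at ha
    omega
  obtain ⟨A, B, u, w, rfl, hu, hw, huH, hwH, hau, hbw⟩ :=
    exists_crossing (D := D) hmnd (fun x hx ↦ hperm.mem_iff.2 (hHl x hx)) haH hb ha
      (fun x y hxy hx hy ↦ hFD x y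
        ((hl x y ((hiff x y).1 (Or.inl (Or.inl hxy)))).resolve_right fun h ↦ hx h.1) hx hy)
      (hd a haH) (hd b hbH) (hcard ⟨a, haH, b, hbH, hne, hG⟩)
  have hAne : A ≠ [] := by rintro rfl; simp at hu
  have hBne : B ≠ [] := by rintro rfl; simp at hw
  rw [List.head?_append_of_ne_nil _ hAne] at hb
  rw [List.getLast?_append_of_ne_nil _ hBne] at ha
  have hrev : (A ++ B.reverse).Perm l := ((List.reverse_perm B).append_left A).trans hperm
  have hlt : (cyclicGaps G (A ++ B.reverse)).ncard < (cyclicGaps G l).ncard := by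
    rw [← hgap]
    exact Set.ncard_lt_ncard (cyclicGaps_reverse_ssubset hmnd hb ha hu hw hau hbw hG)
      (Set.toFinite _)
  have hgood : ∀ x y, CyclicAdj (A ++ B.reverse) x y → F.Adj x y ∨ (x ∈ H ∧ y ∈ H) := by
    intro x y hxy
    have hold := fun h ↦ hl x y ((hiff x y).1 ((cyclicAdj_append_iff hAne hBne x y).2 h))
    rw [cyclicAdj_append_iff hAne (by simpa using hBne)] at hxy
    simp only [listAdj_reverse_iff, List.head?_reverse, List.getLast?_reverse, hb, ha, hu, hw,
      Option.some.injEq] at hxy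
    rcases hxy with h | h | (⟨rfl, rfl⟩ | ⟨rfl, rfl⟩) | (⟨rfl, rfl⟩ | ⟨rfl, rfl⟩)
    · exact hold (Or.inl h)
    · exact hold (Or.inr (Or.inl h))
    all_goals tauto
  obtain ⟨m', hm', hadj'⟩ := ih _ hlt (hrev.nodup_iff.2 hnd) (hrev.length_eq ▸ hlen)
    (fun x hx ↦ hrev.mem_iff.2 (hHl x hx)) hgood rfl
  exact ⟨m', hm'.trans hrev, hadj'⟩

/-- In a list containing all edges of `F` as consecutive pairs, the cyclic neighbours of an entry
with two `F`-neighbours are its `F`-neighbours. -/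
lemma adj_of_cyclicAdj {V : Type*} {F : SimpleGraph V} {l : List V} {x y y₁ y₂ : V}
    (hnd : l.Nodup) (hne : y₁ ≠ y₂) (h₁ : F.Adj x y₁) (h₂ : F.Adj x y₂)
    (hl₁ : ListAdj l x y₁) (hl₂ : ListAdj l x y₂) (h : CyclicAdj l x y) : F.Adj x y := by
  obtain ⟨s, t, rfl⟩ := List.append_of_mem hl₁.mem_left
  rw [listAdj_append_cons_self_iff hnd] at hl₁ hl₂
  have hxs : x ∉ s := by grind
  have hxt : x ∉ t := by grind
  have hs : s ≠ [] := by rintro rfl; grind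
  have ht : t ≠ [] := by rintro rfl; grind
  rcases h with h | ⟨h, -⟩ | ⟨-, h⟩
  · rw [listAdj_append_cons_self_iff hnd] at h
    grind
  · rw [List.head?_append_of_ne_nil _ hs] at h
    exact (hxs (List.mem_of_head? h)).elim
  · rw [List.getLast?_append_of_ne_nil _ (by simp), List.getLast?_cons_of_ne_nil ht] at h
    exact (hxt (List.mem_of_getLast? h)).elim

namespace PathIn

variable {V : Type*} {G : SimpleGraph V}

lemma isEndpoint_or_mem_internals (P : PathIn G) {x : V} (hx : x ∈ P.walk.support) :
    P.IsEndpoint x ∨ x ∈ P.internals := by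
  have hx' := hx
  rw [← Walk.cons_tail_support, List.mem_cons] at hx'
  rcases hx' with h | h
  · exact Or.inl (Or.inl h)
  · have hne : P.walk.support.tail ≠ [] := List.ne_nil_of_mem h
    rw [← List.dropLast_append_getLast hne, List.mem_append, List.mem_singleton] at h
    rcases h with h | h
    · exact Or.inr h
    · refine Or.inl (Or.inr ?_)
      rw [h, List.getLast_tail, Walk.getLast_support]

end PathIn

section segUnionGraph

variable {V : Type*} {G : SimpleGraph V} {r : ℕ} {P : Fin r → PathIn G} {H : Set V}

lemma segUnionGraph_adj {x y : V} :
    (segUnionGraph P).Adj x y ↔ ∃ i, (P i).walk.toSubgraph.Adj x y := by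
  simp [segUnionGraph]

lemma segUnionGraph_le : segUnionGraph P ≤ G :=
  Subgraph.spanningCoe_le _

lemma IsSegmentSystem.isEndpoint (h : IsSegmentSystem G H P) {i : Fin r} {x : V}
    (hx : x ∈ (P i).verts) (hxH : x ∈ H) : (P i).IsEndpoint x :=
  ((P i).isEndpoint_or_mem_internals hx).resolve_right fun hi ↦ (h.1 i).2.2.2 x hi hxH

/-- Vertices of a segment outside the terminal set have two neighbours in the union. -/
lemma IsSegmentSystem.exists_adj (h : IsSegmentSystem G H P) {i : Fin r} {x : V}
    (hx : x ∈ (P i).verts) (hxH : x ∉ H) :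
    ∃ y z, y ≠ z ∧ (segUnionGraph P).Adj x y ∧ (segUnionGraph P).Adj x z := by
  obtain ⟨-, hfirst, hlast, -⟩ := h.1 i
  obtain ⟨j, rfl, hj⟩ := Walk.mem_support_iff_exists_getVert.1 hx
  have h0 : j ≠ 0 := by
    rintro rfl
    exact hxH (by simpa using hfirst)
  have hl : j ≠ (P i).walk.length := by
    rintro rfl
    exact hxH (by simpa using hlast)
  obtain ⟨y, z, hyz, hset⟩ := Set.ncard_eq_two.1
    ((P i).isPath.ncard_neighborSet_toSubgraph_internal_eq_two h0 (by omega))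
  refine ⟨y, z, hyz, segUnionGraph_adj.2 ⟨i, ?_⟩, segUnionGraph_adj.2 ⟨i, ?_⟩⟩
  · rw [← Subgraph.mem_neighborSet, hset]; simp
  · rw [← Subgraph.mem_neighborSet, hset]; simp

end segUnionGraph

/-- Let `k ≥ 1` and let `H` be (the vertex set of) an induced subgraph of `G` with
`δ(H) ≥ max {5k - 3, |V(H)| - k}`. If `G` has a system of `V(H)`-segments
`P_1, …, P_r` with `1 ≤ r ≤ k` whose total number of vertices outside `V(H)` is at
least `p`, then `G` contains a cycle with at least `|V(H)| + p` vertices. -/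
theorem cycle_of_segmentSystem {V : Type*} [Fintype V] (G : SimpleGraph V)
    (k p r : ℕ) (hk : 1 ≤ k) (hr1 : 1 ≤ r) (hrk : r ≤ k) (H : Set V)
    (hδ : ∀ v ∈ H, max (5 * k - 3) (H.ncard - k) ≤ (G.neighborSet v ∩ H).ncard)
    (P : Fin r → PathIn G) (hsys : IsSegmentSystem G H P)
    (hp : p ≤ outsideCount H P) :
    ∃ (v : V) (c : G.Walk v v), c.IsCycle ∧ H.ncard + p ≤ c.length := by
  classical
  set F := segUnionGraph P with hF
  set U : Set V := ⋃ i, (P i).verts with hU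
  set D : Set V := Set.range (fun i ↦ (P i).first) ∪ Set.range fun i ↦ (P i).last with hDdef
  have hDcard : D.ncard ≤ 2 * k := by
    have hrange : ∀ f : Fin r → V, (Set.range f).ncard ≤ r := fun f ↦ by
      rw [← Set.image_univ]
      simpa [Set.ncard_univ] using Set.ncard_image_le (f := f) (Set.toFinite Set.univ)
    have h1 := hrange fun i ↦ (P i).first
    have h2 := hrange fun i ↦ (P i).last
    have h3 := Set.ncard_union_le (Set.range fun i ↦ (P i).first) (Set.range fun i ↦ (P i).last)
    exact h3.trans (by omega)
  have hmemU : ∀ x y, F.Adj x y → y ∈ U := fun x y hxy ↦ by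
    obtain ⟨i, hi⟩ := segUnionGraph_adj.1 hxy
    exact Set.mem_iUnion.2 ⟨i, Walk.mem_support_of_adj_toSubgraph hi.symm⟩
  have hFD : ∀ x y, F.Adj x y → x ∉ H → y ∈ H → y ∈ D := fun x y hxy _ hy ↦ by
    obtain ⟨i, hi⟩ := Set.mem_iUnion.1 (hmemU x y hxy)
    rcases hsys.isEndpoint hi hy with h | h
    · exact Or.inl ⟨i, h.symm⟩
    · exact Or.inr ⟨i, h.symm⟩
  have hHcard : 5 * k - 2 ≤ H.ncard := by
    have h0 : (P ⟨0, hr1⟩).first ∈ H := (hsys.1 ⟨0, hr1⟩).2.1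
    have h1 := hδ _ h0
    have h2 : (G.neighborSet (P ⟨0, hr1⟩).first ∩ H).ncard < H.ncard :=
      Set.ncard_lt_ncard ⟨Set.inter_subset_right, fun h ↦ G.loopless.irrefl _ (h h0).1⟩
        (Set.toFinite _)
    omega
  obtain ⟨l, hnd, hmem, hadj⟩ := hsys.2.2.exists_list (H ∪ U).toFinset
  simp only [Set.mem_toFinset] at hmem hadj
  have hlen : l.length = H.ncard + outsideCount H P := by
    rw [← List.toFinset_card_of_nodup hnd, outsideCount, ← hU,
      ← Set.ncard_union_eq Set.disjoint_sdiff_right (Set.toFinite _) (Set.toFinite _),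
      Set.union_sdiff_self, ← Set.ncard_coe_finset]
    congr 1
    ext x
    simp [hmem]
  have hmeml : ∀ x y, CyclicAdj l x y → x ∈ l := fun x y h ↦ by
    rcases h with h | ⟨h, -⟩ | ⟨-, h⟩
    exacts [h.mem_left, List.mem_of_head? h, List.mem_of_getLast? h]
  have hout : ∀ x y, CyclicAdj l x y → x ∉ H → F.Adj x y := fun x y hxy hx ↦ by
    have hxU : x ∈ U := ((hmem x).1 (hmeml x y hxy)).resolve_left hx
    obtain ⟨i, hi⟩ := Set.mem_iUnion.1 hxU
    obtain ⟨y₁, y₂, hne, h₁, h₂⟩ := hsys.exists_adj hi hx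
    exact adj_of_cyclicAdj hnd hne h₁ h₂
      (hadj x (Or.inr hxU) y₁ (Or.inr (hmemU _ _ h₁)) h₁)
      (hadj x (Or.inr hxU) y₂ (Or.inr (hmemU _ _ h₂)) h₂) hxy
  obtain ⟨m, hperm, hm⟩ := exists_perm_cyclicAdj_imp_adj (D := D) (d := H.ncard - k)
    (segUnionGraph_le : F ≤ G) (fun x hx ↦ (le_max_right _ _).trans (hδ x hx)) hFD
    (by
      rintro ⟨a, ha, b, hb, hne, hab⟩
      have h1 := hδ a ha
      have h2 : (G.neighborSet a ∩ H).ncard + 2 ≤ H.ncard := by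
        rw [← Set.ncard_pair hne, ← Set.ncard_union_eq]
        · exact Set.ncard_le_ncard (by rintro x (h | rfl | rfl); exacts [h.2, ha, hb])
            (Set.toFinite _)
        · rw [Set.disjoint_left]
          rintro x ⟨hx, -⟩ (rfl | rfl)
          exacts [G.loopless.irrefl _ hx, hab hx]
      omega)
    hnd (by omega) (fun x hx ↦ (hmem x).2 (Or.inl hx))
    (fun x y hxy ↦ by
      by_cases hx : x ∈ H
      · by_cases hy : y ∈ H
        · exact Or.inr ⟨hx, hy⟩
        · exact Or.inl (hout y x (cyclicAdj_comm.1 hxy) hy).symm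
      · exact Or.inl (hout x y hxy hx))
  have hmlen := hperm.length_eq
  obtain ⟨v, c, hc, hclen⟩ := exists_isCycle_of_cyclicAdj (hperm.nodup_iff.2 hnd) (by omega) hm
  exact ⟨v, c, hc, by omega⟩
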